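/- arXiv:1612.03771 — 3 statements merged into one kernel-verified Lean document; each statement's English description precedes it below -/
import Mathlib

section
/- Let t = 2t'+1 be an odd positive integer and let λ be a self-conjugate partition with Littlewood decomposition Ω(λ) = (λ̃, λ^0, ..., λ^{t-1}). Let v be a box of λ^{t'} and let V be the box of λ canonically associated with v under the Littlewood decomposition's bijection between boxes of λ with hook length divisible by t and boxes of the t-quotient. Then v lies strictly above the principal diagonal of λ^{t'} if and only if V lies strictly above the principal diagonal of λ. -/
/-!
Statement 6 (Lemma `littlewood3` (ii)): let `t = 2t'+1` be odd and `λ` a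
self-conjugate partition with Littlewood decomposition `Ω(λ) = (λ̃, λ⁰, …, λ^{t-1})`.
If `v` is a box of `λ^{t'}` and `V` the box of `λ` canonically associated with
`v`, then `v` lies strictly above the principal diagonal of `λ^{t'}` iff `V`
lies strictly above the principal diagonal of `λ`.

Encoding: a partition is encoded by its beta-set `S(λ) = {λ_i - i : i ≥ 1} ⊆ ℤ`;
its boxes correspond canonically to the pairs `(a, b)` with `a ∈ S`, `b ∉ S`,
`b < a` (the hook length of the box being `a - b`); the row (resp. column) index
of the box `(a, b)` is `#{x ∈ S : x > a}` (resp. `#{x ∉ S : x < b}`), so the box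
is strictly above the principal diagonal iff the column index is less than the
row index. The component `λ^r` of the `t`-quotient is encoded by
`S_r = {m : t·m + r ∈ S}`, and the canonical Littlewood correspondence of boxes
sends the box `(a, b)` of `λ^r` to the box `(t·a + r, t·b + r)` of `λ`.
-/

noncomputable section

/-- The beta-set of a Young diagram: `{λ_{i+1} - (i+1) : i ≥ 0} ⊆ ℤ`. -/
def betaSet (μ : YoungDiagram) : Set ℤ :=
  Set.range fun i : ℕ => (μ.rowLen i : ℤ) - i - 1

/-- The beta-set of the `r`-th component of the `t`-quotient of `μ`. -/
def quotSet (μ : YoungDiagram) (t r : ℕ) : Set ℤ :=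
  {m : ℤ | (t : ℤ) * m + r ∈ betaSet μ}

/-- The row index of the box encoded by the pair `(a, _)` of the partition
encoded by `T`. -/
def rowIdx (T : Set ℤ) (a : ℤ) : ℕ :=
  Nat.card {x : ℤ // x ∈ T ∧ a < x}

/-- The column index of the box encoded by the pair `(_, b)` of the partition
encoded by `T`. -/
def colIdx (T : Set ℤ) (b : ℤ) : ℕ :=
  Nat.card {x : ℤ // x ∉ T ∧ x < b}

/-- The box encoded by `(a, b)` in the partition encoded by `T` lies strictly
above the principal diagonal: its row index exceeds its column index. -/
def aboveDiag (T : Set ℤ) (a b : ℤ) : Prop :=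
  colIdx T b < rowIdx T a

theorem betaSet_aux1 (μ : YoungDiagram) (i j : ℕ) :
    (μ.rowLen i : ℤ) - i - 1 ≠ j - μ.colLen j := by
  have h1 := @YoungDiagram.mem_iff_lt_rowLen μ i j
  have h2 := @YoungDiagram.mem_iff_lt_colLen μ i j
  rw [h1] at h2
  omega

theorem betaSet_aux2 (μ : YoungDiagram) (x : ℤ) :
    (∃ i : ℕ, (μ.rowLen i : ℤ) - i - 1 = x) ∨ (∃ j : ℕ, (j : ℤ) - μ.colLen j = x) := by
  classical
  have hex : ∃ i : ℕ, (μ.rowLen i : ℤ) - i - 1 ≤ x := by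
    refine ⟨μ.rowLen 0 + x.natAbs, ?_⟩
    have := μ.rowLen_anti 0 (μ.rowLen 0 + x.natAbs) (Nat.zero_le _)
    omega
  have hs := Nat.find_spec hex
  have hm := fun k => @Nat.find_min _ _ hex k
  generalize Nat.find hex = i at hs hm
  by_cases he : (μ.rowLen i : ℤ) - i - 1 = x
  · exact Or.inl ⟨i, he⟩
  right
  have hj : ∃ j : ℕ, (j : ℤ) = x + i := ⟨(x + i).toNat, by omega⟩
  obtain ⟨j, hj⟩ := hj
  refine ⟨j, ?_⟩
  have h1 := (@YoungDiagram.mem_iff_lt_rowLen μ i j).symm.trans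
    (@YoungDiagram.mem_iff_lt_colLen μ i j)
  rcases Nat.eq_zero_or_pos i with h0 | h0
  · omega
  · have h2 := (@YoungDiagram.mem_iff_lt_rowLen μ (i-1) j).symm.trans
      (@YoungDiagram.mem_iff_lt_colLen μ (i-1) j)
    have h3 := hm (i-1) (by omega)
    omega

theorem betaSet_symm (μ : YoungDiagram) (hsc : μ.transpose = μ) (x : ℤ) :
    x ∉ betaSet μ ↔ -1 - x ∈ betaSet μ := by
  have hc : ∀ j, μ.colLen j = μ.rowLen j := fun j => by
    conv_rhs => rw [← hsc]
    simp
  unfold betaSet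
  simp only [Set.mem_range]
  constructor
  · intro h
    rcases betaSet_aux2 μ x with h' | ⟨j, hj⟩
    · exact absurd h' h
    · exact ⟨j, by rw [hc] at hj; omega⟩
  · rintro ⟨j, hj⟩ ⟨i, hi⟩
    have := betaSet_aux1 μ i j
    rw [hc] at this
    omega

theorem betaSet_lt (μ : YoungDiagram) (x : ℤ) (hx : x ∈ betaSet μ) : x < μ.rowLen 0 := by
  obtain ⟨i, rfl⟩ := hx
  have := μ.rowLen_anti 0 i (Nat.zero_le _)
  simp only
  omega

theorem aboveDiag_iff_lt (T : Set ℤ) (N : ℤ) (hN : ∀ x ∈ T, x < N)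
    (hs : ∀ x, x ∉ T ↔ -1 - x ∈ T) (a b : ℤ) (ha : a ∈ T) (hb : b ∉ T) :
    aboveDiag T a b ↔ a < -1 - b := by
  have hcol : colIdx T b = rowIdx T (-1 - b) := by
    unfold colIdx rowIdx
    refine Nat.card_congr ⟨fun x => ⟨-1 - x.1, (hs _).1 x.2.1, by have := x.2.2; omega⟩,
      fun x => ⟨-1 - x.1, (hs _).2 (by simpa using x.2.1), by have := x.2.2; omega⟩, ?_, ?_⟩
    · intro x; simp
    · intro x; simp
  have hfin : ∀ c : ℤ, {x : ℤ | x ∈ T ∧ c < x}.Finite := fun c =>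
    (Set.finite_Ioo c N).subset fun x hx => ⟨hx.2, hN x hx.1⟩
  have hr : ∀ c, rowIdx T c = {x : ℤ | x ∈ T ∧ c < x}.ncard := fun c => rfl
  unfold aboveDiag
  rw [hcol]
  constructor
  · intro h
    by_contra hle
    refine absurd h (not_lt.2 ?_)
    rw [hr, hr]
    exact Set.ncard_le_ncard (fun x hx => ⟨hx.1, by have := hx.2; omega⟩) (hfin _)
  · intro h
    rw [hr, hr]
    refine Set.ncard_lt_ncard ?_ (hfin _)
    have hsub : {x : ℤ | x ∈ T ∧ -1 - b < x} ⊆ {x : ℤ | x ∈ T ∧ a < x} :=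
      fun x hx => ⟨hx.1, h.trans hx.2⟩
    exact (Set.ssubset_iff_of_subset hsub).2
      ⟨-1 - b, ⟨(hs b).1 hb, h⟩, fun hx => lt_irrefl _ hx.2⟩

theorem littlewood_SC_middle_box (t' : ℕ) (μ : YoungDiagram) (hsc : μ.transpose = μ)
    (a b : ℤ) (ha : a ∈ quotSet μ (2 * t' + 1) t') (hb : b ∉ quotSet μ (2 * t' + 1) t')
    (hba : b < a) :
    aboveDiag (quotSet μ (2 * t' + 1) t') a b ↔
      aboveDiag (betaSet μ) ((2 * t' + 1 : ℕ) * a + t') ((2 * t' + 1 : ℕ) * b + t') := by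
  have hq : ∀ x, x ∉ quotSet μ (2 * t' + 1) t' ↔ -1 - x ∈ quotSet μ (2 * t' + 1) t' := by
    intro x
    have h := betaSet_symm μ hsc (((2 * t' + 1 : ℕ) : ℤ) * x + t')
    have e : -1 - (((2 * t' + 1 : ℕ) : ℤ) * x + t') =
        ((2 * t' + 1 : ℕ) : ℤ) * (-1 - x) + t' := by push_cast; ring
    rw [e] at h
    exact h
  have hqN : ∀ x ∈ quotSet μ (2 * t' + 1) t', x < μ.rowLen 0 + 1 := by
    intro x hx
    have h := betaSet_lt μ _ hx
    by_contra hc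
    push Not at hc
    push_cast at h
    nlinarith
  rw [aboveDiag_iff_lt _ _ hqN hq a b ha hb,
    aboveDiag_iff_lt _ _ (betaSet_lt μ) (betaSet_symm μ hsc) _ _ ha hb]
  push_cast
  constructor
  · intro h
    have : a + 1 ≤ -1 - b := h
    nlinarith
  · intro h
    by_contra hc
    push Not at hc
    nlinarith
end
end

section
/- Let t be a positive integer, written t = 2t' or t = 2t'+1 according to parity, and let λ be a doubled distinct partition with Littlewood decomposition Ω(λ) = (λ̃, λ^0, ..., λ^{t-1}). Let v be a box of λ^0 and let V be the box of λ canonically associated with v under the Littlewood decomposition's correspondence of boxes. Then v lies strictly above the principal diagonal of λ^0 if and only if V lies strictly above the principal diagonal of λ. Moreover, for 1 ≤ i ≤ t', if v = (j,k) is a box of λ^i, v* = (k,j) the corresponding box of (λ^i)*, and V, V* the boxes of λ canonically associated with v, v*, then V lies strictly above the principal diagonal of λ if and only if V* lies strictly below it. -/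
/-!
Statement 12 (Lemma `littlewood` (ii)–(iii)): let `t` be a positive integer and
`λ` a doubled distinct partition with Littlewood decomposition
`Ω(λ) = (λ̃, λ⁰, …, λ^{t-1})`.
(ii) A box `v` of `λ⁰` lies strictly above the principal diagonal of `λ⁰` iff
the canonically associated box `V` of `λ` lies strictly above the principal
diagonal of `λ`.
(iii) For `1 ≤ i ≤ t'` (`t' = t/2`), if `v = (j,k)` is a box of `λ^i`,
`v* = (k,j)` the corresponding box of `λ^{t-i} = (λ^i)*`, and `V`, `V*` the
boxes of `λ` canonically associated with `v`, `v*`, then `V` lies strictly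
above the principal diagonal of `λ` iff `V*` lies strictly below it.

Encoding: a partition is encoded by its beta-set `S(λ) = {λ_i - i : i ≥ 1} ⊆ ℤ`;
its boxes correspond to pairs `(a, b)`, `a ∈ S`, `b ∉ S`, `b < a`, with row
index `#{x ∈ S : x > a}` and column index `#{x ∉ S : x < b}`. The component
`λ^r` is encoded by `S_r = {m : t·m + r ∈ S}`; the box `(a,b)` of `λ^i`
corresponds to the box `V = (t·a+i, t·b+i)` of `λ`, and (for a doubled distinct
`λ`, whose beta-set satisfies `n ∈ S ↔ -n ∉ S` for `n ≠ 0`) the conjugate box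
`v* = (k,j)` of `λ^{t-i}` corresponds to the box `V* = (-(t·b+i), -(t·a+i))`
of `λ`.
-/

noncomputable section

/-- The box encoded by `(a, b)` lies strictly below the principal diagonal. -/
def belowDiag (T : Set ℤ) (a b : ℤ) : Prop :=
  rowIdx T a < colIdx T b

/-- A Young diagram is doubled distinct if, in Frobenius coordinates,
`a_i = b_i + 1` for every diagonal cell. -/
def DDiagram (μ : YoungDiagram) : Prop :=
  ∀ i : ℕ, (i, i) ∈ μ → μ.rowLen i = μ.colLen i + 1

lemma rowIdx_eq (T : Set ℤ) (a : ℤ) : rowIdx T a = {x : ℤ | x ∈ T ∧ a < x}.ncard := rfl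

lemma colIdx_eq (T : Set ℤ) (a : ℤ) : colIdx T a = {x : ℤ | x ∉ T ∧ x < a}.ncard := rfl

lemma row_fin (T : Set ℤ) (M : ℤ) (hb : ∀ x ∈ T, x ≤ M) (a : ℤ) :
    {x : ℤ | x ∈ T ∧ a < x}.Finite :=
  (Set.finite_Ioc a M).subset fun x hx => ⟨hx.2, hb x hx.1⟩

lemma row_anti (T : Set ℤ) (M : ℤ) (hb : ∀ x ∈ T, x ≤ M) (a c : ℤ) (h : a ≤ c) :
    rowIdx T c ≤ rowIdx T a := by
  rw [rowIdx_eq, rowIdx_eq]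
  exact Set.ncard_le_ncard (fun x hx => ⟨hx.1, lt_of_le_of_lt h hx.2⟩) (row_fin T M hb a)

lemma row_strict (T : Set ℤ) (M : ℤ) (hb : ∀ x ∈ T, x ≤ M) (a c : ℤ) (h : a < c)
    (hc : c ∈ T) : rowIdx T c < rowIdx T a := by
  rw [rowIdx_eq, rowIdx_eq]
  refine Set.ncard_lt_ncard ⟨fun x hx => ⟨hx.1, lt_trans h hx.2⟩, fun hh => ?_⟩ (row_fin T M hb a)
  exact lt_irrefl c (hh ⟨hc, h⟩ : c ∈ T ∧ c < c).2

lemma col_nonpos (T : Set ℤ) (hs : ∀ n : ℤ, n ≠ 0 → (n ∈ T ↔ -n ∉ T)) (b : ℤ) (h : b ≤ 0) :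
    colIdx T b = rowIdx T (-b) := by
  rw [rowIdx_eq, colIdx_eq, ← Set.ncard_image_of_injective _ neg_injective]
  congr 1
  ext x
  simp only [Set.mem_image, Set.mem_setOf_eq]
  constructor
  · rintro ⟨y, ⟨hy, hyb⟩, rfl⟩
    exact ⟨(hs (-y) (by omega)).2 (by simpa using hy), by omega⟩
  · rintro ⟨hx, hxb⟩
    exact ⟨-x, ⟨(hs x (by omega)).1 hx, by omega⟩, by simp⟩

lemma col_pos (T : Set ℤ) (h0 : (0 : ℤ) ∉ T) (M : ℤ) (hb : ∀ x ∈ T, x ≤ M)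
    (hs : ∀ n : ℤ, n ≠ 0 → (n ∈ T ↔ -n ∉ T)) (b : ℤ) (h : 0 < b) :
    colIdx T b = rowIdx T (-b) + 1 := by
  rw [rowIdx_eq, colIdx_eq, ← Set.ncard_image_of_injective _ neg_injective,
    ← Set.ncard_insert_of_notMem (a := (0 : ℤ)) (fun hh => h0 hh.1) (row_fin T M hb _)]
  congr 1
  ext x
  simp only [Set.mem_image, Set.mem_setOf_eq, Set.mem_insert_iff]
  constructor
  · rintro ⟨y, ⟨hy, hyb⟩, rfl⟩
    by_cases hy0 : y = 0
    · left; omega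
    · right
      exact ⟨(hs (-y) (by omega)).2 (by simpa using hy), by omega⟩
  · rintro (rfl | ⟨hx, hxb⟩)
    · exact ⟨0, ⟨h0, h⟩, by simp⟩
    · have hx0 : x ≠ 0 := fun e => h0 (e ▸ hx)
      exact ⟨-x, ⟨(hs x hx0).1 hx, by omega⟩, by simp⟩

lemma above_iff (T : Set ℤ) (h0 : (0 : ℤ) ∉ T) (M : ℤ) (hb : ∀ x ∈ T, x ≤ M)
    (hs : ∀ n : ℤ, n ≠ 0 → (n ∈ T ↔ -n ∉ T)) (a b : ℤ) (hbT : b ∉ T)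
    (hab : b < a) : aboveDiag T a b ↔ a + b < 0 := by
  unfold aboveDiag
  rcases le_or_gt b 0 with h | h
  · rw [col_nonpos T hs b h]
    constructor
    · intro hlt
      by_contra hn
      have := row_anti T M hb (-b) a (by omega)
      omega
    · intro hlt
      exact row_strict T M hb a (-b) (by omega) ((hs (-b) (by omega)).2 (by simpa using hbT))
  · rw [col_pos T h0 M hb hs b h]
    have := row_anti T M hb (-b) a (by omega)
    constructor <;> intro <;> omega

lemma below_iff (T : Set ℤ) (h0 : (0 : ℤ) ∉ T) (M : ℤ) (hb : ∀ x ∈ T, x ≤ M)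
    (hs : ∀ n : ℤ, n ≠ 0 → (n ∈ T ↔ -n ∉ T)) (a b : ℤ) (haT : a ∈ T) (hbT : b ∉ T)
    (hb0 : b ≠ 0) (hab : b < a) : belowDiag T (-b) (-a) ↔ a + b < 0 := by
  unfold belowDiag
  have ha0 : a ≠ 0 := fun e => h0 (e ▸ haT)
  rcases lt_or_gt_of_ne ha0 with h | h
  · rw [col_pos T h0 M hb hs (-a) (by omega), neg_neg]
    have := row_anti T M hb a (-b) (by omega)
    constructor <;> intro <;> omega
  · rw [col_nonpos T hs (-a) (by omega), neg_neg]
    constructor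
    · intro hlt
      by_contra hn
      have := row_anti T M hb (-b) a (by omega)
      omega
    · intro hlt
      exact row_strict T M hb a (-b) (by omega) ((hs (-b) (by omega)).2 (by simpa using hbT))

lemma not_mem_betaSet (μ : YoungDiagram) (x : ℤ) :
    x ∉ betaSet μ ↔ ∃ j : ℕ, x = (j : ℤ) - μ.colLen j := by
  constructor
  · intro hx
    have hex : ∃ i : ℕ, (μ.rowLen i : ℤ) - i - 1 ≤ x := by
      refine ⟨μ.rowLen 0 + x.natAbs, ?_⟩
      have := μ.rowLen_anti 0 (μ.rowLen 0 + x.natAbs) (Nat.zero_le _)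
      omega
    classical
    obtain ⟨i, hi, hmin⟩ : ∃ i : ℕ, (μ.rowLen i : ℤ) - i - 1 ≤ x ∧
        ∀ k < i, ¬ ((μ.rowLen k : ℤ) - k - 1 ≤ x) :=
      ⟨Nat.find hex, Nat.find_spec hex, fun k hk => Nat.find_min hex hk⟩
    have hne : (μ.rowLen i : ℤ) - i - 1 ≠ x := fun e => hx ⟨i, e⟩
    obtain ⟨j, hj⟩ : ∃ j : ℕ, (j : ℤ) = x + i := ⟨(x + i).toNat, by omega⟩
    refine ⟨j, ?_⟩
    have h1 : ¬ i < μ.colLen j := by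
      rw [← YoungDiagram.mem_iff_lt_colLen, YoungDiagram.mem_iff_lt_rowLen]
      omega
    have h2 : i ≤ μ.colLen j := by
      rcases Nat.eq_zero_or_pos i with h | h
      · omega
      · have := hmin (i - 1) (by omega)
        have h3 : i - 1 < μ.colLen j := by
          rw [← YoungDiagram.mem_iff_lt_colLen, YoungDiagram.mem_iff_lt_rowLen]
          omega
        omega
    omega
  · rintro ⟨j, rfl⟩ ⟨i, hi⟩
    have h1 := YoungDiagram.mem_iff_lt_colLen (μ := μ) (i := i) (j := j)
    have h2 := YoungDiagram.mem_iff_lt_rowLen (μ := μ) (i := i) (j := j)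
    have h3 := h1.symm.trans h2
    simp only at hi
    omega

lemma beta_pos (μ : YoungDiagram) (hdd : DDiagram μ) (n : ℤ) (hn : 0 < n) :
    n ∈ betaSet μ ↔ -n ∉ betaSet μ := by
  rw [not_mem_betaSet]
  have key : ∀ i, i < μ.rowLen i ∨ i < μ.colLen i → μ.rowLen i = μ.colLen i + 1 := by
    intro i hi
    apply hdd
    rcases hi with h | h
    · exact YoungDiagram.mem_iff_lt_rowLen.2 h
    · exact YoungDiagram.mem_iff_lt_colLen.2 h
  constructor
  · rintro ⟨i, hi⟩
    simp only at hi
    have := key i (by omega)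
    exact ⟨i, by omega⟩
  · rintro ⟨i, hi⟩
    have := key i (by omega)
    exact ⟨i, by simp only; omega⟩

lemma beta_symm (μ : YoungDiagram) (hdd : DDiagram μ) (n : ℤ) (hn : n ≠ 0) :
    n ∈ betaSet μ ↔ -n ∉ betaSet μ := by
  rcases lt_or_gt_of_ne hn with h | h
  · have := beta_pos μ hdd (-n) (by omega)
    rw [neg_neg] at this
    tauto
  · exact beta_pos μ hdd n h

lemma beta_zero (μ : YoungDiagram) (hdd : DDiagram μ) : (0 : ℤ) ∉ betaSet μ := by
  rintro ⟨i, hi⟩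
  simp only at hi
  have hm : (i, i) ∈ μ := YoungDiagram.mem_iff_lt_rowLen.2 (by omega)
  have h1 := hdd i hm
  have h2 := YoungDiagram.mem_iff_lt_colLen.1 hm
  omega

lemma beta_bdd (μ : YoungDiagram) : ∀ x ∈ betaSet μ, x ≤ (μ.rowLen 0 : ℤ) := by
  rintro x ⟨i, rfl⟩
  have := μ.rowLen_anti 0 i (Nat.zero_le _)
  simp only
  omega

theorem littlewood_DD_boxes (t : ℕ) (ht : 0 < t) (μ : YoungDiagram)
    (hdd : DDiagram μ) :
    (∀ a b : ℤ, a ∈ quotSet μ t 0 → b ∉ quotSet μ t 0 → b < a →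
      (aboveDiag (quotSet μ t 0) a b ↔
        aboveDiag (betaSet μ) ((t : ℤ) * a) ((t : ℤ) * b))) ∧
    (∀ i : ℕ, 1 ≤ i → i ≤ t / 2 →
      ∀ a b : ℤ, a ∈ quotSet μ t i → b ∉ quotSet μ t i → b < a →
        (aboveDiag (betaSet μ) ((t : ℤ) * a + i) ((t : ℤ) * b + i) ↔
          belowDiag (betaSet μ) (-((t : ℤ) * b + i)) (-((t : ℤ) * a + i)))) := by
  have h0 := beta_zero μ hdd
  have hs := beta_symm μ hdd
  have hb := beta_bdd μ
  have ht' : (0 : ℤ) < t := by exact_mod_cast ht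
  constructor
  · intro a b ha hbT hab
    have hm : ∀ m : ℤ, m ∈ quotSet μ t 0 ↔ (t : ℤ) * m ∈ betaSet μ := by
      intro m; simp [quotSet]
    rw [above_iff (quotSet μ t 0) (by rw [hm]; simpa using h0) (μ.rowLen 0) ?_ ?_ a b hbT hab,
      above_iff (betaSet μ) h0 _ hb hs _ _ (by rwa [← hm]) (mul_lt_mul_of_pos_left hab ht')]
    · rw [← mul_add]
      constructor
      · intro h; exact mul_neg_of_pos_of_neg ht' h
      · intro h; exact neg_of_mul_neg_right h ht'.le
    · intro x hx
      have h1 := hb _ ((hm x).1 hx)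
      by_contra hlt
      nlinarith
    · intro n hn
      rw [hm, hm, mul_neg]
      exact hs _ (mul_ne_zero ht'.ne' hn)
  · intro i hi1 hi2 a b ha hbT hab
    have hlt : (t : ℤ) * b + i < (t : ℤ) * a + i := by
      have := mul_lt_mul_of_pos_left hab ht'
      omega
    have hb0 : (t : ℤ) * b + i ≠ 0 := by
      intro e
      have hd : (t : ℤ) ∣ i := ⟨-b, by linarith⟩
      have := Int.le_of_dvd (by omega) hd
      omega
    rw [above_iff (betaSet μ) h0 _ hb hs _ _ hbT hlt,
      below_iff (betaSet μ) h0 _ hb hs _ _ ha hbT hb0 hlt]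
end
end

section
/- Let λ be a self-conjugate partition with largest part λ_1 ≥ 1, and let Δ^g = {h_{i,i} = 2(λ_i - i) + 1 : 1 ≤ i ≤ λ_1} be its set of generalized principal hook lengths (where λ_i := 0 for i > ℓ(λ)). Then for every odd integer i with 1 ≤ i ≤ 2λ_1 - 1, exactly one of i and -i belongs to Δ^g; that is, (i) at least one of i, -i belongs to Δ^g, and (ii) if i belongs to Δ^g then -i does not. -/
/-!
Statement 18 (Lemma `lemme+-`): let `λ` be a self-conjugate partition with
largest part `λ₁ ≥ 1` and let
`Δᵍ = {h_{i,i} = 2(λ_i - i) + 1 : 1 ≤ i ≤ λ₁}` be its set of generalized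
principal hook lengths (with `λ_i := 0` for `i > ℓ(λ)`). Then for every odd
integer `i` with `1 ≤ i ≤ 2λ₁ - 1`:
(i) `i ∈ Δᵍ` or `-i ∈ Δᵍ`, and (ii) if `i ∈ Δᵍ` then `-i ∉ Δᵍ`.

In terms of a Young diagram `μ` (0-indexed rows), `λ_i = μ.rowLen (i-1)` and
`λ₁ = μ.rowLen 0`, so
`Δᵍ = {2(μ.rowLen j - (j+1)) + 1 : 0 ≤ j < μ.rowLen 0}`.
-/

noncomputable section

/-- The set of generalized principal hook lengths of a self-conjugate
partition: `{2(λ_i - i) + 1 : 1 ≤ i ≤ λ₁} ⊆ ℤ`. -/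
def genPrincipalHooks (μ : YoungDiagram) : Set ℤ :=
  {x : ℤ | ∃ j : ℕ, j < μ.rowLen 0 ∧ x = 2 * ((μ.rowLen j : ℤ) - (j + 1)) + 1}

theorem gen_principal_hooks_plus_minus (μ : YoungDiagram) (hsc : μ.transpose = μ)
    (hpos : 0 < μ.rowLen 0) (i : ℤ) (hodd : Odd i) (h1 : 1 ≤ i)
    (h2 : i ≤ 2 * (μ.rowLen 0 : ℤ) - 1) :
    (i ∈ genPrincipalHooks μ ∨ -i ∈ genPrincipalHooks μ) ∧
    (i ∈ genPrincipalHooks μ → -i ∉ genPrincipalHooks μ) := by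
  have S : ∀ a b : ℕ, b < μ.rowLen a ↔ a < μ.rowLen b := by
    intro a b
    rw [← YoungDiagram.mem_iff_lt_rowLen, ← YoungDiagram.mem_iff_lt_rowLen]
    conv_lhs => rw [← hsc, YoungDiagram.mem_transpose]
    rfl
  obtain ⟨m, rfl⟩ := hodd
  obtain ⟨k, rfl⟩ : ∃ k : ℕ, m = k := ⟨m.toNat, by omega⟩
  constructor
  · have hex : ∃ a, μ.rowLen a ≤ a + k := by
      refine ⟨μ.rowLen 0, ?_⟩
      have := μ.rowLen_anti 0 (μ.rowLen 0) (Nat.zero_le _)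
      omega
    classical
    obtain ⟨a, ha, hmin⟩ : ∃ a, μ.rowLen a ≤ a + k ∧ ∀ b < a, ¬ μ.rowLen b ≤ b + k :=
      ⟨Nat.find hex, Nat.find_spec hex, fun b hb => Nat.find_min hex hb⟩
    rcases a with _ | c
    · omega
    have hc := hmin c (Nat.lt_succ_self c)
    have h0 := μ.rowLen_anti 0 c (Nat.zero_le _)
    by_cases h : μ.rowLen c = c + 1 + k
    · left
      exact ⟨c, by omega, by omega⟩
    · right
      have s1 := S c (c + 1 + k)
      have s2 := S (c + 1) (c + 1 + k)
      exact ⟨c + 1 + k, by omega, by omega⟩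
  · rintro ⟨a, ha, ea⟩ ⟨b, hb, eb⟩
    have := S a b
    omega
end
end
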